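/- If U is a universal prefix-free machine and M is any prefix-free machine whose domain contains the domain of U, then Ω_M is Martin-Löf random. -/

import Mathlib

open scoped Classical

/-- A set of binary strings is prefix-free if no element is a proper prefix of another. -/
def PrefixFreeSet (D : Set (List Bool)) : Prop :=
  ∀ σ ∈ D, ∀ τ ∈ D, σ <+: τ → σ = τ

/-- A prefix-free machine: a partial computable function on binary strings
whose domain is prefix-free. -/
structure PFMachine where
  f : List Bool →. List Bool
  partrec : Partrec f
  prefixFree : PrefixFreeSet {σ | (f σ).Dom}

/-- The halting probability `Ω_M = Σ_{σ ∈ dom M} 2^{-|σ|}` of a prefix-free machine. -/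
noncomputable def omegaOf (M : PFMachine) : ℝ :=
  ∑' σ : {σ : List Bool // (M.f σ).Dom}, (2 : ℝ) ^ (-(σ.1.length : ℤ))

/-- A computable nondecreasing sequence of rationals converging to `x`. -/
def LeftCEApprox (q : ℕ → ℚ) (x : ℝ) : Prop :=
  Computable q ∧ Monotone q ∧
    Filter.Tendsto (fun n => (q n : ℝ)) Filter.atTop (nhds x)

/-- A real is left-c.e. if some computable nondecreasing rational sequence converges to it. -/
def LeftCE (x : ℝ) : Prop := ∃ q : ℕ → ℚ, LeftCEApprox q x

/-- A real is right-c.e. if its negative is left-c.e. -/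
def RightCE (x : ℝ) : Prop := LeftCE (-x)

/-- Martin-Löf randomness of a real, via computable sequences of open rational intervals. -/
def MLRandom (x : ℝ) : Prop :=
  ∀ I : ℕ → ℕ → ℚ × ℚ, Computable₂ I →
    (∀ n : ℕ, MeasureTheory.volume
        (⋃ k : ℕ, Set.Ioo (((I n k).1 : ℝ)) (((I n k).2 : ℝ))) ≤ 2 ^ (-(n : ℤ))) →
    x ∉ ⋂ n : ℕ, ⋃ k : ℕ, Set.Ioo (((I n k).1 : ℝ)) (((I n k).2 : ℝ))

/-- A universal prefix-free machine: it simulates every prefix-free machine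
via a fixed prefix. -/
def UniversalPF (U : PFMachine) : Prop :=
  ∀ M : PFMachine, ∃ ρ : List Bool, ∀ σ : List Bool, U.f (ρ ++ σ) = M.f σ

/-- The `i`-th binary digit of a real (of its expansion not ending in all 1s). -/
noncomputable def rdigit (x : ℝ) (i : ℕ) : Bool := decide (⌊x * 2 ^ (i + 1)⌋ % 2 = 1)

/-- The first `n` binary digits of a real. -/
noncomputable def bits (x : ℝ) (n : ℕ) : List Bool := (List.range n).map (rdigit x)

/-- Prefix-free Kolmogorov complexity of `σ` with respect to machine `M`,
with value `⊤` if `σ` is not in the range. -/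
noncomputable def Kf (M : PFMachine) (σ : List Bool) : ℕ∞ :=
  ⨅ p : {p : List Bool // σ ∈ M.f p}, (p.1.length : ℕ∞)

/-- An optimal prefix-free machine: minimizes `K` up to additive constants. -/
def OptimalPF (V : PFMachine) : Prop :=
  ∀ M : PFMachine, ∃ c : ℕ, ∀ σ : List Bool, Kf V σ ≤ Kf M σ + c

/-- Solovay reducibility for left-c.e. reals. -/
def SolovayRed (α β : ℝ) : Prop :=
  ∃ c : ℚ, ∃ f : ℚ →. ℚ, Partrec f ∧
    ∀ q : ℚ, (q : ℝ) < β →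
      ∃ r ∈ f q, (r : ℝ) < α ∧ α - (r : ℝ) < (c : ℝ) * (β - (q : ℝ))

/-- `X` is computable from `Y` with oracle-use `h`. -/
def ComputableFromWithUse (X Y : ℝ) (h : ℕ → ℕ) : Prop :=
  ∃ Φ : List Bool →. List Bool, Partrec Φ ∧
    ∀ n : ℕ, Φ (bits Y (h n)) = Part.some (bits X n)

/-- A strictly increasing function on `ℕ` whose range is decidable is computable. -/
theorem computable_of_strictMono {e : ℕ → ℕ} (he : StrictMono e) {p : ℕ → Bool}
    (hp : Computable p) (hrange : ∀ x, p x = true ↔ x ∈ Set.range e) : Computable e := by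
  have hstep : ∀ n x, p x = true → e n < x → e (n + 1) ≤ x := by
    intro n x hx hlt
    obtain ⟨m, rfl⟩ := (hrange x).1 hx
    exact he.monotone (he.lt_iff_lt.1 hlt)
  let next : ℕ →. ℕ := fun y => Nat.rfind fun x => Part.some (p x && decide (y < x))
  have hnext : Partrec next := by
    refine Partrec.rfind (p := fun y x => Part.some (p x && decide (y < x))) ?_
    have h : Computable₂ fun y x : ℕ => (p x && decide (y < x)) :=
      (Primrec.and.to_comp.comp (hp.comp Computable.snd)
        (Primrec.nat_lt.decide.to_comp.comp Computable.fst Computable.snd))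
    exact h.partrec₂
  have key : ∀ n, e (n + 1) ∈ next (e n) := by
    intro n
    refine Nat.mem_rfind.2 ⟨?_, ?_⟩
    · simp [(hrange _).2 ⟨n + 1, rfl⟩, he (Nat.lt_succ_self n)]
    · intro m hm
      simp only [Part.mem_some_iff, Bool.false_eq, Bool.and_eq_false_iff, decide_eq_false_iff_not]
      by_contra! h
      exact absurd (hstep n m (by simpa using h.1) h.2) (by omega)
  have hrec : Partrec fun n : ℕ =>
      (n.rec (Part.some (e 0)) fun _ ih => ih.bind fun i => next i : Part ℕ) :=
    Partrec.nat_rec (f := fun n : ℕ => n) (g := fun _ : ℕ => Part.some (e 0))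
      (h := fun _ q => next q.2) Computable.id (Computable.const (e 0)).partrec
      (hnext.comp (Computable.snd.comp Computable.snd))
  refine hrec.of_eq_tot fun n => ?_
  induction n with
  | zero => exact Part.mem_some _
  | succ n ih => exact Part.mem_bind ih (key n)

theorem Primrec.nat_pow : Primrec₂ ((· ^ ·) : ℕ → ℕ → ℕ) :=
  Primrec₂.unpaired'.1 Nat.Primrec.pow

theorem primrecRel_coprime : PrimrecRel fun m d : ℕ => 0 < d ∧ m.Coprime d := by
  have h1 : PrimrecRel fun (x : ℕ) (y : ℕ × ℕ) => (y.1 * x) % y.2 = 1 % y.2 :=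
    Primrec.eq.comp
      (Primrec.nat_mod.comp (Primrec.nat_mul.comp (Primrec.fst.comp Primrec.snd) Primrec.fst)
        (Primrec.snd.comp Primrec.snd))
      (Primrec.nat_mod.comp (Primrec.const 1) (Primrec.snd.comp Primrec.snd))
  have h2 : PrimrecPred fun y : ℕ × ℕ => ∃ x ∈ List.range y.2, (y.1 * x) % y.2 = 1 % y.2 :=
    h1.exists_mem_list.comp (Primrec.list_range.comp Primrec.snd) Primrec.id
  have h3 : PrimrecPred fun y : ℕ × ℕ => 0 < y.2 :=
    Primrec.nat_lt.comp (Primrec.const 0) Primrec.snd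
  refine (h3.and h2).of_eq ?_
  rintro ⟨m, d⟩
  refine and_congr_right fun hd => ⟨?_, fun h => ?_⟩
  · rintro ⟨x, -, hx⟩
    have h : (m * x) ≡ 1 [MOD d] := hx
    have h4 : (m * x).Coprime d := by
      rw [Nat.Coprime, h.gcd_eq, Nat.gcd_one_left]
    exact Nat.Coprime.coprime_mul_right h4
  · obtain ⟨x, hx, h4⟩ := Nat.exists_mul_mod_eq_of_coprime 1 h hd.ne'
    exact ⟨x, List.mem_range.2 hx, h4⟩

theorem Rat.encode_eq (q : ℚ) :
    @Encodable.encode ℚ Rat.instEncodable q = Nat.pair (Encodable.encode q.num) q.den := by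
  cases q; rfl

theorem Int.natAbs_eq_encode (z : ℤ) : z.natAbs = (Encodable.encode z + 1) / 2 := by
  cases z with
  | ofNat n => 
    change n = (2 * n + 1) / 2
    omega
  | negSucc n =>
    change n + 1 = (2 * n + 1 + 1) / 2
    omega

theorem Int.toNat_eq_encode (z : ℤ) :
    z.toNat = Encodable.encode z / 2 * (1 - Encodable.encode z % 2) := by
  cases z with
  | ofNat n =>
    change n = (2 * n) / 2 * (1 - (2 * n) % 2)
    simp
  | negSucc n =>
    change 0 = (2 * n + 1) / 2 * (1 - (2 * n + 1) % 2)
    simp [Nat.add_mod]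

theorem Rat.mem_range_encode (x : ℕ) :
    x ∈ Set.range (@Encodable.encode ℚ Rat.instEncodable) ↔
      0 < x.unpair.2 ∧ ((x.unpair.1 + 1) / 2).Coprime x.unpair.2 := by
  constructor
  · rintro ⟨q, rfl⟩
    rw [Rat.encode_eq, Nat.unpair_pair, ← Int.natAbs_eq_encode]
    exact ⟨q.pos, q.reduced⟩
  · rintro ⟨h1, h2⟩
    have h3 : Encodable.encode (Denumerable.ofNat ℤ x.unpair.1) = x.unpair.1 :=
      Denumerable.encode_ofNat _
    refine ⟨⟨Denumerable.ofNat ℤ x.unpair.1, x.unpair.2, h1.ne', ?_⟩, ?_⟩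
    · rw [Int.natAbs_eq_encode, h3]
      exact h2
    · rw [Rat.encode_eq]
      exact (congrArg (Nat.pair · _) h3).trans (Nat.pair_unpair x)

theorem Rat.computable_encode : Computable (@Encodable.encode ℚ Rat.instEncodable) := by
  let := Encodable.decidableRangeEncode ℚ
  have : Infinite (Set.range (@Encodable.encode ℚ Rat.instEncodable)) :=
    Infinite.of_injective _ (Encodable.equivRangeEncode ℚ).injective
  have heq : ∀ n, @Encodable.encode ℚ Rat.instEncodable (Denumerable.ofNat ℚ n) =
      (Nat.Subtype.ofNat (Set.range (@Encodable.encode ℚ Rat.instEncodable)) n : ℕ) := fun n =>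
    congrArg Subtype.val (Equiv.apply_symm_apply (Encodable.equivRangeEncode ℚ) _)
  have hmono : StrictMono fun n =>
      @Encodable.encode ℚ Rat.instEncodable (Denumerable.ofNat ℚ n) := by
    refine strictMono_nat_of_lt_succ fun n => ?_
    rw [heq, heq]
    exact Nat.Subtype.lt_succ_self _
  have hdec : PrimrecPred fun x : ℕ =>
      0 < x.unpair.2 ∧ ((x.unpair.1 + 1) / 2).Coprime x.unpair.2 :=
    primrecRel_coprime.comp
      (Primrec.nat_div.comp (Primrec.succ.comp (Primrec.fst.comp Primrec.unpair))
        (Primrec.const 2))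
      (Primrec.snd.comp Primrec.unpair)
  have hcomp := computable_of_strictMono hmono hdec.decide.to_comp fun x => by
    rw [decide_eq_true_iff, ← Rat.mem_range_encode]
    constructor
    · rintro ⟨q, rfl⟩
      exact ⟨@Encodable.encode ℚ Rat.instDenumerable.toEncodable q,
        congrArg _ (Denumerable.ofNat_encode q)⟩
    · rintro ⟨n, rfl⟩
      exact ⟨_, rfl⟩
  refine (hcomp.comp Computable.encode).of_eq fun q => ?_
  exact congrArg _ (Denumerable.ofNat_encode q)

theorem Rat.natCeil_mul_two_pow_eq (q : ℚ) (K : ℕ) :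
    ⌈q * 2 ^ K⌉₊ = (q.num.toNat * 2 ^ K + (q.den - 1)) / q.den := by
  have hd := q.pos
  refine eq_of_forall_ge_iff fun n => ?_
  have h : q * 2 ^ K = (q.num * 2 ^ K : ℤ) / q.den := by
    push_cast
    rw [mul_div_right_comm, Rat.num_div_den]
  rw [Nat.ceil_le, h, div_le_iff₀ (by exact_mod_cast hd), ← Nat.lt_succ_iff,
    Nat.div_lt_iff_lt_mul hd]
  have h1 : ((q.num * 2 ^ K : ℤ) : ℚ) ≤ n * q.den ↔ q.num * 2 ^ K ≤ (n * q.den : ℤ) := by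
    exact_mod_cast Iff.rfl
  rw [h1, Nat.succ_mul]
  have h2 : q.num * 2 ^ K ≤ (n * q.den : ℤ) ↔ q.num.toNat * 2 ^ K ≤ n * q.den := by
    rcases le_total 0 q.num with h0 | h0
    · lift q.num to ℕ using h0 with z
      exact_mod_cast Iff.rfl
    · rw [Int.toNat_of_nonpos h0]
      refine iff_of_true ?_ (by simp)
      exact (mul_nonpos_of_nonpos_of_nonneg h0 (by positivity)).trans (by positivity)
  rw [h2]
  omega

theorem Rat.computable_natCeil_mul_two_pow :
    Computable₂ fun (q : ℚ) (K : ℕ) => ⌈q * 2 ^ K⌉₊ := by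
  have h1 : Primrec₂ fun (x K : ℕ) =>
      (x.unpair.1 / 2 * (1 - x.unpair.1 % 2) * 2 ^ K + (x.unpair.2 - 1)) / x.unpair.2 := by
    have ha : Primrec fun y : ℕ × ℕ => y.1.unpair.1 :=
      Primrec.fst.comp (Primrec.unpair.comp Primrec.fst)
    have hb : Primrec fun y : ℕ × ℕ => y.1.unpair.2 :=
      Primrec.snd.comp (Primrec.unpair.comp Primrec.fst)
    exact Primrec.nat_div.comp (Primrec.nat_add.comp (Primrec.nat_mul.comp (Primrec.nat_mul.comp
      (Primrec.nat_div.comp ha (Primrec.const 2))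
      (Primrec.nat_sub.comp (Primrec.const 1) (Primrec.nat_mod.comp ha (Primrec.const 2))))
      (Primrec.nat_pow.comp (Primrec.const 2) Primrec.snd))
      (Primrec.nat_sub.comp hb (Primrec.const 1))) hb
  have h2 := h1.to_comp.comp (Rat.computable_encode.comp (Computable.fst (α := ℚ) (β := ℕ)))
    Computable.snd
  refine Computable.of_eq h2 fun y => ?_
  beta_reduce
  rw [Rat.natCeil_mul_two_pow_eq, Int.toNat_eq_encode, Rat.encode_eq, Nat.unpair_pair]

theorem PFMachine.exists_stages (M : PFMachine) : ∃ H : ℕ → List Bool → Bool, Computable₂ H ∧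
    (∀ σ s t, s ≤ t → H s σ = true → H t σ = true) ∧
    ∀ σ, (M.f σ).Dom ↔ ∃ s, H s σ = true := by
  obtain ⟨c, hc⟩ := Nat.Partrec.Code.exists_code.1 M.partrec
  have hsome : ∀ s n, (Nat.Partrec.Code.evaln s c n).isSome = true ↔
      ∃ x, x ∈ Nat.Partrec.Code.evaln s c n := fun s n => Option.isSome_iff_exists
  refine ⟨fun s σ => (Nat.Partrec.Code.evaln s c (Encodable.encode σ)).isSome, ?_, ?_, ?_⟩
  · have h : Primrec fun p : ℕ × List Bool =>
        (Nat.Partrec.Code.evaln p.1 c (Encodable.encode p.2)).isSome :=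
      Primrec.option_isSome.comp (Nat.Partrec.Code.primrec_evaln.comp
        (Primrec.pair (Primrec.pair Primrec.fst (Primrec.const c))
          (Primrec.encode.comp Primrec.snd)))
    exact h.to_comp
  · intro σ s t hst h
    rw [hsome] at h ⊢
    exact h.imp fun x hx => Nat.Partrec.Code.evaln_mono hst hx
  · intro σ
    have h : (c.eval (Encodable.encode σ)).Dom ↔ (M.f σ).Dom := by
      rw [hc]
      simp
    rw [← h, Part.dom_iff_mem]
    simp only [hsome, Nat.Partrec.Code.evaln_complete]
    exact exists_comm

/-- The strings with code below `s` accepted by `H s`. -/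
noncomputable def stageSet (H : ℕ → List Bool → Bool) (s : ℕ) : Finset (List Bool) :=
  ((Finset.range s).preimage Encodable.encode Encodable.encode_injective.injOn).filter
    fun σ => H s σ = true

/-- The measure of `stageSet H s`, in units of `2 ^ (-K)`. -/
def stageSum (H : ℕ → List Bool → Bool) (s K : ℕ) : ℕ :=
  ∑ i ∈ Finset.range s, ((Encodable.decode i : Option (List Bool)).elim 0
    fun σ => bif decide (Encodable.encode σ = i) && H s σ then 2 ^ (K - σ.length) else 0)

theorem stageSum_eq (H : ℕ → List Bool → Bool) (s K : ℕ) :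
    stageSum H s K = ∑ σ ∈ stageSet H s, 2 ^ (K - σ.length) := by
  rw [stageSum, stageSet, Finset.sum_filter,
    ← Finset.sum_preimage (Encodable.encode (α := List Bool)) (Finset.range s)
      Encodable.encode_injective.injOn]
  · refine Finset.sum_congr rfl fun σ _ => ?_
    rw [Encodable.encodek, Option.elim_some, Bool.cond_eq_ite, decide_eq_true rfl, Bool.true_and]
  · intro i _ hi
    cases h : (Encodable.decode i : Option (List Bool)) with
    | none => rfl
    | some σ =>
      have h1 : Encodable.encode σ ≠ i := fun h1 => hi ⟨σ, h1⟩
      rw [Option.elim_some, decide_eq_false h1, Bool.false_and, cond_false]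

theorem length_lt_of_mem_stageSet {H : ℕ → List Bool → Bool} {s : ℕ} {σ : List Bool}
    (h : σ ∈ stageSet H s) : σ.length < s := by
  simp only [stageSet, Finset.mem_filter, Finset.mem_preimage, Finset.mem_range] at h
  exact (Encodable.length_le_encode σ).trans_lt h.1

theorem computable_sum_range {α : Type*} [Primcodable α] {f : α → ℕ → ℕ} {n : α → ℕ}
    (hf : Computable₂ f) (hn : Computable n) :
    Computable fun a => ∑ i ∈ Finset.range (n a), f a i := by
  have h : Computable fun a => (Nat.rec 0 (fun i x => x + f a i) (n a) : ℕ) :=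
    Computable.nat_rec (h := fun a p => p.2 + f a p.1) hn (Computable.const 0)
      (Primrec.nat_add.to_comp.comp (Computable.snd.comp Computable.snd)
        (hf.comp Computable.fst (Computable.fst.comp Computable.snd)))
  refine h.of_eq fun a => ?_
  induction n a with
  | zero => rfl
  | succ k ih => rw [Finset.sum_range_succ, ← ih]

theorem computable_stageSum {H : ℕ → List Bool → Bool} (hH : Computable₂ H) :
    Computable₂ (stageSum H) := by
  refine computable_sum_range (f := fun (p : ℕ × ℕ) i =>
    ((Encodable.decode i : Option (List Bool)).elim 0
      fun σ => bif decide (Encodable.encode σ = i) && H p.1 σ then 2 ^ (p.2 - σ.length) else 0))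
    ?_ Computable.fst
  have h : Computable fun q : (ℕ × ℕ) × ℕ =>
      (Option.casesOn (Encodable.decode q.2 : Option (List Bool)) 0
      fun σ => bif decide (Encodable.encode σ = q.2) && H q.1.1 σ then
        2 ^ (q.1.2 - σ.length) else 0 : ℕ) := by
    refine Computable.option_casesOn
      (g := fun (q : (ℕ × ℕ) × ℕ) σ => bif decide (Encodable.encode σ = q.2) && H q.1.1 σ then
        2 ^ (q.1.2 - σ.length) else 0)
      (Computable.decode.comp Computable.snd) (Computable.const 0) ?_
    have h1 : Computable fun r : ((ℕ × ℕ) × ℕ) × List Bool => r.1.1 :=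
      Computable.fst.comp Computable.fst
    have h2 : PrimrecPred fun r : ((ℕ × ℕ) × ℕ) × List Bool => Encodable.encode r.2 = r.1.2 :=
      Primrec.eq.comp (Primrec.encode.comp Primrec.snd) (Primrec.snd.comp Primrec.fst)
    exact Computable.cond
      (Primrec.and.to_comp.comp h2.decide.to_comp
        (hH.comp (Computable.fst.comp h1) Computable.snd))
      (Primrec.nat_pow.to_comp.comp (Computable.const 2)
        (Primrec.nat_sub.to_comp.comp (Computable.snd.comp h1)
          (Computable.list_length.comp Computable.snd))) (Computable.const 0)
  refine h.of_eq fun q => ?_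
  beta_reduce
  cases (Encodable.decode q.2 : Option (List Bool)) <;> rfl

/-- The online allocation process with approximations `A` from below and targets `B`, where the
unit at stage `s + 1` is half of the unit at stage `s`. The first component is the largest target
seen so far, the second one the amount allocated so far. -/
def alloc (A B : ℕ → ℕ) : ℕ → ℕ × ℕ
  | 0 => (0, 0)
  | s + 1 => (2 * max (alloc A B s).1 (B s),
      2 * ((alloc A B s).2 + (B s - max (A s) (alloc A B s).1)))

theorem computable_alloc {A B : ℕ → ℕ → ℕ} (hA : Computable₂ A) (hB : Computable₂ B) :
    Computable₂ fun j s => alloc (A j) (B j) s := by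
  have h : Computable fun p : ℕ × ℕ => (Nat.rec (0, 0) (fun s x => (2 * max x.1 (B p.1 s),
      2 * (x.2 + (B p.1 s - max (A p.1 s) x.1)))) p.2 : ℕ × ℕ) := by
    refine Computable.nat_rec (h := fun (p : ℕ × ℕ) (y : ℕ × (ℕ × ℕ)) =>
      (2 * max y.2.1 (B p.1 y.1), 2 * (y.2.2 + (B p.1 y.1 - max (A p.1 y.1) y.2.1))))
      Computable.snd (Computable.const (0, 0)) ?_
    have h1 : Computable fun r : (ℕ × ℕ) × (ℕ × (ℕ × ℕ)) => r.1.1 :=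
      Computable.fst.comp Computable.fst
    have h2 : Computable fun r : (ℕ × ℕ) × (ℕ × (ℕ × ℕ)) => r.2.1 :=
      Computable.fst.comp Computable.snd
    have h3 : Computable fun r : (ℕ × ℕ) × (ℕ × (ℕ × ℕ)) => r.2.2.1 :=
      Computable.fst.comp (Computable.snd.comp Computable.snd)
    have h4 : Computable fun r : (ℕ × ℕ) × (ℕ × (ℕ × ℕ)) => r.2.2.2 :=
      Computable.snd.comp (Computable.snd.comp Computable.snd)
    exact Computable.pair
      (Primrec.nat_double.to_comp.comp (Primrec.nat_max.to_comp.comp h3 (hB.comp h1 h2)))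
      (Primrec.nat_double.to_comp.comp (Primrec.nat_add.to_comp.comp h4
        (Primrec.nat_sub.to_comp.comp (hB.comp h1 h2)
          (Primrec.nat_max.to_comp.comp (hA.comp h1 h2) h3))))
  refine h.of_eq fun p => ?_
  obtain ⟨j, s⟩ := p
  induction s with
  | zero => rfl
  | succ s ih =>
    dsimp only at ih ⊢
    rw [alloc, ← ih]

/-- The number written in binary by a string, most significant digit first. -/
def binVal (σ : List Bool) : ℕ := σ.foldl (fun a b => 2 * a + b.toNat) 0

theorem primrec_binVal : Primrec binVal := by
  refine Primrec.list_foldl (h := fun (_ : List Bool) (q : ℕ × Bool) => 2 * q.1 + q.2.toNat)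
    Primrec.id (Primrec.const 0) ?_
  exact Primrec.nat_add.comp (Primrec.nat_double.comp (Primrec.fst.comp Primrec.snd))
    ((Primrec.dom_bool Bool.toNat).comp (Primrec.snd.comp Primrec.snd))

theorem binVal_concat (σ : List Bool) (b : Bool) : binVal (σ ++ [b]) = 2 * binVal σ + b.toNat := by
  simp [binVal]

theorem binVal_append (σ τ : List Bool) :
    binVal (σ ++ τ) = binVal σ * 2 ^ τ.length + binVal τ := by
  induction τ using List.reverseRecOn with
  | nil => simp [binVal]
  | append_singleton τ b ih =>
    rw [← List.append_assoc, binVal_concat, binVal_concat, ih, List.length_append,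
      List.length_singleton]
    ring

theorem binVal_lt (σ : List Bool) : binVal σ < 2 ^ σ.length := by
  induction σ using List.reverseRecOn with
  | nil => simp [binVal]
  | append_singleton σ b ih =>
    rw [binVal_concat, List.length_append, List.length_singleton, pow_succ]
    have := b.toNat_le
    omega

theorem exists_binVal_eq (L v : ℕ) (h : v < 2 ^ L) :
    ∃ σ : List Bool, σ.length = L ∧ binVal σ = v := by
  induction L generalizing v with
  | zero => exact ⟨[], rfl, by simp at h; simp [binVal, h]⟩
  | succ L ih =>
    obtain ⟨σ, h1, h2⟩ := ih (v / 2) (by rw [pow_succ] at h; omega)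
    refine ⟨σ ++ [decide (v % 2 = 1)], by simp [h1], ?_⟩
    rw [binVal_concat, h2]
    rcases Nat.mod_two_eq_zero_or_one v with h3 | h3 <;> simp [h3] <;> omega

theorem binVal_replicate_false (j : ℕ) : binVal (List.replicate j false) = 0 := by
  induction j with
  | zero => rfl
  | succ j ih => rw [List.replicate_succ', binVal_concat, ih]; rfl

/-- Membership in the code which, on strings starting with `0 ^ j 1`, runs through the allocations
of `alloc (A j) (B j)`: at stage `s` these are consecutive strings of length `s + 2`. -/
def allocMem (A B : ℕ → ℕ → ℕ) (σ : List Bool) : Bool :=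
  let j := σ.idxOf true
  let s := σ.length - (j + 3)
  let x := (alloc (A j) (B j) s).2
  decide (σ.length = j + 3 + s) && (decide (2 ^ (s + 2) + x ≤ binVal σ) &&
    decide (binVal σ < 2 ^ (s + 2) + (x + (B j s - max (A j s) (alloc (A j) (B j) s).1))))

theorem computable_allocMem {A B : ℕ → ℕ → ℕ} (hA : Computable₂ A) (hB : Computable₂ B) :
    Computable (allocMem A B) := by
  have hj : Computable fun σ : List Bool => σ.idxOf true :=
    (Primrec.list_idxOf.comp (Primrec.const true) Primrec.id).to_comp
  have hl : Computable fun σ : List Bool => σ.length := Computable.list_length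
  have hj3 : Computable fun σ : List Bool => σ.idxOf true + 3 :=
    Primrec.nat_add.to_comp.comp hj (Computable.const 3)
  have hs : Computable fun σ : List Bool => σ.length - (σ.idxOf true + 3) :=
    Primrec.nat_sub.to_comp.comp hl hj3
  have hal := (computable_alloc hA hB).comp hj hs
  have hx := Computable.snd.comp hal
  have hr := Computable.fst.comp hal
  have hp : Computable fun σ : List Bool => 2 ^ (σ.length - (σ.idxOf true + 3) + 2) :=
    Primrec.nat_pow.to_comp.comp (Computable.const 2)
      (Primrec.nat_add.to_comp.comp hs (Computable.const 2))
  have hm := Primrec.nat_sub.to_comp.comp (hB.comp hj hs)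
    (Primrec.nat_max.to_comp.comp (hA.comp hj hs) hr)
  have hv : Computable binVal := primrec_binVal.to_comp
  exact Primrec.and.to_comp.comp
    (Primrec.eq.decide.to_comp.comp hl (Primrec.nat_add.to_comp.comp hj3 hs))
    (Primrec.and.to_comp.comp
      (Primrec.nat_le.decide.to_comp.comp (Primrec.nat_add.to_comp.comp hp hx) hv)
      (Primrec.nat_lt.decide.to_comp.comp hv
        (Primrec.nat_add.to_comp.comp hp (Primrec.nat_add.to_comp.comp hx hm))))

theorem allocMem_iff {A B : ℕ → ℕ → ℕ} {j s : ℕ} {σ : List Bool} (hj : σ.idxOf true = j)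
    (hs : σ.length = j + 3 + s) : allocMem A B σ = true ↔
      2 ^ (s + 2) + (alloc (A j) (B j) s).2 ≤ binVal σ ∧ binVal σ < 2 ^ (s + 2) +
        ((alloc (A j) (B j) s).2 + (B j s - max (A j s) (alloc (A j) (B j) s).1)) := by
  have h : j + 3 + s - (j + 3) = s := by omega
  simp only [allocMem, hj, hs, h, Bool.and_eq_true, decide_eq_true_eq, true_and]

theorem length_eq_of_allocMem {A B : ℕ → ℕ → ℕ} {σ : List Bool} (h : allocMem A B σ = true) :
    σ.length = σ.idxOf true + 3 + (σ.length - (σ.idxOf true + 3)) := by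
  simp only [allocMem, Bool.and_eq_true, decide_eq_true_eq] at h
  exact h.1

theorem two_pow_mul_le_alloc (A B : ℕ → ℕ) (s d : ℕ) :
    2 ^ (d + 1) * ((alloc A B s).2 + (B s - max (A s) (alloc A B s).1)) ≤
      (alloc A B (s + (d + 1))).2 := by
  induction d with
  | zero => simp [alloc]
  | succ d ih =>
    rw [← Nat.add_assoc s, alloc, pow_succ, mul_comm _ 2, mul_assoc]
    dsimp only
    omega

theorem prefixFreeSet_allocMem (A B : ℕ → ℕ → ℕ) :
    PrefixFreeSet {σ | allocMem A B σ = true} := by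
  rintro σ hσ τ hτ ⟨ν, rfl⟩
  rw [Set.mem_ofPred_eq] at hσ hτ
  have hσl := length_eq_of_allocMem hσ
  generalize hj : σ.idxOf true = j at hσl
  generalize hs : σ.length - (j + 3) = s at hσl
  have hmem : true ∈ σ := List.idxOf_lt_length_iff.1 (by omega)
  have hj' : (σ ++ ν).idxOf true = j := by rw [List.idxOf_append_of_mem hmem, hj]
  cases hν : ν.length with
  | zero => simp [List.length_eq_zero_iff.1 hν]
  | succ d =>
    have hl : (σ ++ ν).length = j + 3 + (s + (d + 1)) := by
      rw [List.length_append, hσl, hν]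
      omega
    rw [allocMem_iff hj hσl] at hσ
    rw [allocMem_iff hj' hl, binVal_append, hν] at hτ
    have h1 := two_pow_mul_le_alloc (A j) (B j) s d
    have h2 := binVal_lt ν
    rw [hν] at h2
    have h3 := Nat.mul_le_mul_right (2 ^ (d + 1)) (Nat.succ_le_of_lt hσ.2)
    rw [Nat.succ_mul, add_mul, ← pow_add] at h3
    have h4 : s + 2 + (d + 1) = s + (d + 1) + 2 := by omega
    rw [h4, mul_comm (_ + _)] at h3
    omega

/-- A prefix-free machine with domain the code described by `allocMem`. -/
def allocMachine {A B : ℕ → ℕ → ℕ} (hA : Computable₂ A) (hB : Computable₂ B) : PFMachine where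
  f σ := ((bif allocMem A B σ then some [] else none : Option (List Bool)) : Part (List Bool))
  partrec := Computable.ofOption (Computable.cond (computable_allocMem hA hB)
    (Computable.const (some [])) (Computable.const none))
  prefixFree := by
    convert prefixFreeSet_allocMem A B using 3 with σ
    cases allocMem A B σ <;> simp

theorem allocMachine_dom {A B : ℕ → ℕ → ℕ} (hA : Computable₂ A) (hB : Computable₂ B) (j s : ℕ)
    {p : List Bool} (hp : p.length = s + 2) (h1 : (alloc (A j) (B j) s).2 ≤ binVal p)
    (h2 : binVal p < (alloc (A j) (B j) s).2 + (B j s - max (A j s) (alloc (A j) (B j) s).1)) :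
    ((allocMachine hA hB).f (List.replicate j false ++ true :: p)).Dom := by
  have h : allocMem A B (List.replicate j false ++ true :: p) = true := by
    have hv : binVal (true :: p) = 2 ^ (s + 2) + binVal p := by
      rw [← List.singleton_append, binVal_append, hp]
      simp [binVal]
    rw [allocMem_iff (j := j) (s := s), binVal_append, binVal_replicate_false, hv]
    · omega
    · rw [List.idxOf_append_of_notMem (by simp)]
      simp
    · simp [hp]
      omega
  simp [allocMachine, h]

theorem PrefixFreeSet.uniquelyDecodable {D : Set (List Bool)} (hD : PrefixFreeSet D)
    (h : [] ∉ D) : InformationTheory.UniquelyDecodable D := by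
  intro L₁
  induction L₁ with
  | nil =>
    intro L₂ _ h₂ hL
    cases L₂ with
    | nil => rfl
    | cons σ L₂ =>
      have h₃ : σ = [] := (List.append_eq_nil_iff.1 hL.symm).1
      exact absurd (h₃ ▸ h₂ σ List.mem_cons_self) h
  | cons σ L₁ ih =>
    intro L₂ h₁ h₂ hL
    have hσ := h₁ σ List.mem_cons_self
    cases L₂ with
    | nil =>
      have h₃ : σ = [] := (List.append_eq_nil_iff.1 hL).1
      exact absurd (h₃ ▸ hσ) h
    | cons τ L₂ =>
      have hτ := h₂ τ List.mem_cons_self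
      rw [List.flatten_cons, List.flatten_cons] at hL
      have hστ : σ = τ := by
        rcases List.prefix_or_prefix_of_prefix (List.prefix_append σ L₁.flatten)
          (hL ▸ List.prefix_append τ L₂.flatten) with h₃ | h₃
        · exact hD σ hσ τ hτ h₃
        · exact (hD τ hτ σ hσ h₃).symm
      subst hστ
      rw [ih L₂ (fun w hw => h₁ w (List.mem_cons_of_mem _ hw))
        (fun w hw => h₂ w (List.mem_cons_of_mem _ hw)) (List.append_cancel_left hL)]

theorem PrefixFreeSet.sum_le_one {D : Set (List Bool)} (hD : PrefixFreeSet D)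
    {F : Finset (List Bool)} (hF : (F : Set (List Bool)) ⊆ D) :
    ∑ σ ∈ F, (1 / 2 : ℝ) ^ σ.length ≤ 1 := by
  by_cases h : [] ∈ F
  · have hF' : F = {[]} := by
      ext σ
      rw [Finset.mem_singleton]
      exact ⟨fun hσ => (hD [] (hF h) σ (hF hσ) List.nil_prefix).symm, fun hσ => hσ ▸ h⟩
    simp [hF']
  · have hF' : PrefixFreeSet (F : Set (List Bool)) :=
      fun σ hσ τ hτ => hD σ (hF hσ) τ (hF hτ)
    simpa using InformationTheory.kraft_mcmillan_inequality (hF'.uniquelyDecodable h)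

theorem hasSum_omegaOf (M : PFMachine) :
    HasSum (fun σ : {σ : List Bool // (M.f σ).Dom} => (1 / 2 : ℝ) ^ σ.1.length) (omegaOf M) := by
  have h : omegaOf M = ∑' σ : {σ : List Bool // (M.f σ).Dom}, (1 / 2 : ℝ) ^ σ.1.length := by
    refine tsum_congr fun σ => ?_
    rw [zpow_neg, zpow_natCast, one_div, inv_pow]
  rw [h]
  refine (summable_of_sum_le (c := 1) (fun σ => by positivity) fun F => ?_).hasSum
  have := M.prefixFree.sum_le_one (F := F.map (Function.Embedding.subtype _)) (by
    intro σ hσ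
    obtain ⟨τ, -, rfl⟩ := Finset.mem_map.1 (Finset.mem_coe.1 hσ)
    exact τ.2)
  rwa [Finset.sum_map] at this

theorem sum_le_omegaOf (M : PFMachine) {F : Finset (List Bool)} (hF : ∀ σ ∈ F, (M.f σ).Dom) :
    ∑ σ ∈ F, (1 / 2 : ℝ) ^ σ.length ≤ omegaOf M := by
  have h := sum_le_hasSum (F.subtype fun σ => (M.f σ).Dom) (fun σ _ => by positivity)
    (hasSum_omegaOf M)
  rwa [Finset.sum_subtype_of_mem (fun σ : List Bool => (1 / 2 : ℝ) ^ σ.length) hF] at h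

theorem exists_finset_lt_sum (M : PFMachine) {a : ℝ} (ha : a < omegaOf M) :
    ∃ F : Finset (List Bool), (∀ σ ∈ F, (M.f σ).Dom) ∧ a < ∑ σ ∈ F, (1 / 2 : ℝ) ^ σ.length := by
  obtain ⟨F, hF⟩ := ((hasSum_omegaOf M).eventually (lt_mem_nhds ha)).exists
  refine ⟨F.map (Function.Embedding.subtype _), fun σ hσ => ?_, ?_⟩
  · obtain ⟨τ, -, rfl⟩ := Finset.mem_map.1 hσ
    exact τ.2
  · rwa [Finset.sum_map]

theorem exists_subset_stageSet {H : ℕ → List Bool → Bool}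
    (hH : ∀ σ s t, s ≤ t → H s σ = true → H t σ = true) {F : Finset (List Bool)}
    (hF : ∀ σ ∈ F, ∃ s, H s σ = true) : ∃ s₀, ∀ s, s₀ ≤ s → F ⊆ stageSet H s := by
  induction F using Finset.induction_on with
  | empty => exact ⟨0, fun s _ => Finset.empty_subset _⟩
  | insert σ F _ ih =>
    obtain ⟨s₀, h₀⟩ := ih fun τ hτ => hF τ (Finset.mem_insert_of_mem hτ)
    obtain ⟨s₁, h₁⟩ := hF σ (Finset.mem_insert_self σ F)
    refine ⟨max s₀ (max s₁ (Encodable.encode σ + 1)), fun s hs => ?_⟩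
    simp only [max_le_iff] at hs
    refine Finset.insert_subset ?_ (h₀ s hs.1)
    simp only [stageSet, Finset.mem_filter, Finset.mem_preimage, Finset.mem_range]
    exact ⟨hs.2.2, hH σ s₁ s hs.2.1 h₁⟩

theorem stageSum_div_two_pow (H : ℕ → List Bool → Bool) {s K : ℕ} (hK : s ≤ K) :
    (stageSum H s K : ℝ) / 2 ^ K = ∑ σ ∈ stageSet H s, (1 / 2 : ℝ) ^ σ.length := by
  rw [stageSum_eq, Nat.cast_sum, Finset.sum_div]
  refine Finset.sum_congr rfl fun σ hσ => ?_
  have h := (length_lt_of_mem_stageSet hσ).le.trans hK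
  rw [Nat.cast_pow, Nat.cast_ofNat, div_eq_iff (by positivity), one_div, inv_pow,
    ← div_eq_inv_mul, eq_div_iff (by positivity), ← pow_add, Nat.sub_add_cancel h]

theorem alloc_snd_div_le {A B : ℕ → ℕ} {V : Set ℝ} (c : ℕ) (hV : MeasureTheory.volume V ≠ ⊤)
    (h : ∀ s, A s < B s →
      Set.Ioo ((A s : ℝ) / 2 ^ (c + s + 2)) (((B s : ℝ) - 1) / 2 ^ (c + s + 2)) ⊆ V) (s : ℕ) :
    ((alloc A B s).2 : ℝ) / 2 ^ (c + s + 2) ≤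
      MeasureTheory.volume.real (V ∩ Set.Iio (((alloc A B s).1 : ℝ) / 2 ^ (c + s + 2))) +
        (1 / 2 ^ (c + 1) - 1 / 2 ^ (c + s + 1)) := by
  have hfin (y : ℝ) : MeasureTheory.volume (V ∩ Set.Iio y) ≠ ⊤ :=
    MeasureTheory.measure_ne_top_of_subset Set.inter_subset_left hV
  induction s with
  | zero => simp [alloc]
  | succ s ih =>
    have hK : (2 : ℝ) ^ (c + (s + 1) + 2) = 2 * 2 ^ (c + s + 2) := by ring
    have hK' : (2 : ℝ) ^ (c + (s + 1) + 1) = 2 ^ (c + s + 2) := by ring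
    have hK'' : (1 : ℝ) / 2 ^ (c + s + 1) = 2 * (1 / 2 ^ (c + s + 2)) := by
      rw [pow_succ _ (c + s + 1)]
      field_simp
    rw [alloc, hK, hK']
    rw [hK''] at ih
    push_cast
    rw [mul_div_mul_left _ _ two_ne_zero, mul_div_mul_left _ _ two_ne_zero]
    generalize (alloc A B s).2 = x at ih ⊢
    generalize (alloc A B s).1 = r at ih ⊢
    have hs := h s
    have hpos : (0 : ℝ) < 2 ^ (c + s + 2) := by positivity
    generalize (2 : ℝ) ^ (c + s + 2) = P at ih hs hpos ⊢
    have hP : 0 < 1 / P := by positivity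
    rcases le_or_gt (B s) (max (A s) r) with hm | hm
    · have hmono : MeasureTheory.volume.real (V ∩ Set.Iio ((r : ℝ) / P)) ≤
          MeasureTheory.volume.real (V ∩ Set.Iio (max (r : ℝ) (B s) / P)) :=
        MeasureTheory.measureReal_mono (Set.inter_subset_inter_right _
          (Set.Iio_subset_Iio (div_le_div_of_nonneg_right (le_max_left _ _) hpos.le))) (hfin _)
      rw [Nat.sub_eq_zero_of_le hm, Nat.cast_zero, add_zero]
      linarith
    · obtain ⟨hA, hr⟩ := max_lt_iff.1 hm
      have hsub : V ∩ Set.Iio ((r : ℝ) / P) ∪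
          Set.Ioo (((max (A s) r : ℕ) : ℝ) / P) (((B s : ℝ) - 1) / P) ⊆
            V ∩ Set.Iio (max (r : ℝ) (B s) / P) := by
        rintro y (⟨hy1, hy2⟩ | ⟨hy1, hy2⟩)
        · exact ⟨hy1, lt_of_lt_of_le hy2 (div_le_div_of_nonneg_right (le_max_left _ _) hpos.le)⟩
        · refine ⟨hs hA ⟨lt_of_le_of_lt ?_ hy1, hy2⟩, lt_of_lt_of_le hy2 ?_⟩
          · gcongr
            exact le_max_left _ _
          · gcongr
            linarith [le_max_right (r : ℝ) (B s)]
      have hdisj : Disjoint (V ∩ Set.Iio ((r : ℝ) / P))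
          (Set.Ioo (((max (A s) r : ℕ) : ℝ) / P) (((B s : ℝ) - 1) / P)) := by
        rw [Set.disjoint_left]
        rintro y ⟨-, hy1⟩ ⟨hy2, -⟩
        refine absurd (hy2.trans hy1) (not_lt.2 ?_)
        gcongr
        exact le_max_right _ _
      have hle := MeasureTheory.measureReal_mono hsub (hfin _)
      rw [MeasureTheory.measureReal_union hdisj measurableSet_Ioo (hfin _) (by simp),
        Real.volume_real_Ioo] at hle
      have hle' := le_max_left (((B s : ℝ) - 1) / P - ((max (A s) r : ℕ) : ℝ) / P) 0
      rw [Nat.cast_sub hm.le, add_div, sub_div]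
      rw [sub_div] at hle hle'
      linarith

theorem alloc_snd_add_le {A B : ℕ → ℕ} {V : Set ℝ} (c : ℕ)
    (hV : MeasureTheory.volume V ≤ 2 ^ (-((c + 1 : ℕ) : ℤ)))
    (h : ∀ s, A s < B s →
      Set.Ioo ((A s : ℝ) / 2 ^ (c + s + 2)) (((B s : ℝ) - 1) / 2 ^ (c + s + 2)) ⊆ V) (s : ℕ) :
    (alloc A B s).2 + (B s - max (A s) (alloc A B s).1) ≤ 2 ^ (s + 2) := by
  have hV' : (2 : ENNReal) ^ (-((c + 1 : ℕ) : ℤ)) = ENNReal.ofReal (1 / 2 ^ (c + 1)) := by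
    rw [ENNReal.zpow_neg, zpow_natCast, one_div, ENNReal.ofReal_inv_of_pos (by positivity),
      ENNReal.ofReal_pow (by norm_num), ENNReal.ofReal_ofNat]
  rw [hV'] at hV
  have hV₁ : MeasureTheory.volume V ≠ ⊤ := ne_top_of_le_ne_top ENNReal.ofReal_ne_top hV
  have hV₂ : MeasureTheory.volume.real V ≤ 1 / 2 ^ (c + 1) :=
    ENNReal.toReal_le_of_le_ofReal (by positivity) hV
  have h₁ := alloc_snd_div_le c hV₁ h (s + 1)
  have h₂ := MeasureTheory.measureReal_mono (μ := MeasureTheory.volume)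
    (Set.inter_subset_left (s := V)
      (t := Set.Iio (((alloc A B (s + 1)).1 : ℝ) / 2 ^ (c + (s + 1) + 2)))) hV₁
  have h₃ : (0 : ℝ) < 1 / 2 ^ (c + (s + 1) + 1) := by positivity
  have h₄ : ((alloc A B (s + 1)).2 : ℝ) / 2 ^ (c + (s + 1) + 2) ≤ 2 * (1 / 2 ^ (c + 1)) := by
    linarith
  have h₅ : 2 * (1 / (2 : ℝ) ^ (c + 1)) = 2 * 2 ^ (s + 2) / 2 ^ (c + (s + 1) + 2) := by
    field_simp
    ring
  rw [h₅, div_le_div_iff_of_pos_right (by positivity), alloc] at h₄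
  exact_mod_cast le_of_mul_le_mul_left (by exact_mod_cast h₄) (two_pos (α := ℕ))

theorem exists_finset_alloc_le {A B : ℕ → ℕ} (c : ℕ) {D : Set (List Bool)}
    {S : ℕ → Finset (List Bool)} (hSD : ∀ s, ∀ σ ∈ S s, σ ∈ D)
    (hSl : ∀ s, ∀ σ ∈ S s, σ.length < s)
    (hSA : ∀ s, (A s : ℝ) / 2 ^ (c + s + 2) = ∑ σ ∈ S s, (1 / 2 : ℝ) ^ σ.length)
    (hT : ∀ s, ∃ T : Finset (List Bool), (∀ σ ∈ T, σ ∈ D) ∧ (∀ σ ∈ T, σ.length = c + s + 2) ∧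
      T.card = B s - max (A s) (alloc A B s).1) (s : ℕ) :
    ∃ F : Finset (List Bool), (∀ σ ∈ F, σ ∈ D) ∧ (∀ σ ∈ F, σ.length < c + s + 2) ∧
      ((alloc A B s).1 : ℝ) / 2 ^ (c + s + 2) ≤ ∑ σ ∈ F, (1 / 2 : ℝ) ^ σ.length := by
  induction s with
  | zero => exact ⟨∅, by simp, by simp, by simp [alloc]⟩
  | succ s ih =>
    obtain ⟨F, hFD, hFl, hF⟩ := ih
    obtain ⟨T, hTD, hTl, hTc⟩ := hT s
    have hdisj : Disjoint (F ∪ S s) T := by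
      rw [Finset.disjoint_left]
      intro σ hσ hσT
      have h₁ := hTl σ hσT
      rcases Finset.mem_union.1 hσ with h | h
      · have := hFl σ h
        omega
      · have := hSl s σ h
        omega
    refine ⟨F ∪ S s ∪ T, fun σ hσ => ?_, fun σ hσ => ?_, ?_⟩
    · rcases Finset.mem_union.1 hσ with h | h
      · exact (Finset.mem_union.1 h).elim (hFD σ) (hSD s σ)
      · exact hTD σ h
    · rcases Finset.mem_union.1 hσ with h | h
      · rcases Finset.mem_union.1 h with h | h
        · have := hFl σ h
          omega
        · have := hSl s σ h
          omega
      · have := hTl σ h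
        omega
    · have h₁ : ∑ σ ∈ F, (1 / 2 : ℝ) ^ σ.length ≤ ∑ σ ∈ F ∪ S s, (1 / 2 : ℝ) ^ σ.length :=
        Finset.sum_le_sum_of_subset_of_nonneg Finset.subset_union_left fun σ _ _ => by positivity
      have h₂ : ∑ σ ∈ S s, (1 / 2 : ℝ) ^ σ.length ≤ ∑ σ ∈ F ∪ S s, (1 / 2 : ℝ) ^ σ.length :=
        Finset.sum_le_sum_of_subset_of_nonneg Finset.subset_union_right fun σ _ _ => by positivity
      have h₃ : ∑ σ ∈ T, (1 / 2 : ℝ) ^ σ.length = (T.card : ℝ) / 2 ^ (c + s + 2) := by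
        rw [Finset.sum_congr rfl fun σ hσ => by rw [hTl σ hσ], Finset.sum_const, nsmul_eq_mul,
          one_div, inv_pow, div_eq_mul_inv]
      have hK : (2 : ℝ) ^ (c + (s + 1) + 2) = 2 * 2 ^ (c + s + 2) := by ring
      rw [Finset.sum_union hdisj, h₃, hTc, alloc, hK, Nat.cast_mul, Nat.cast_ofNat,
        mul_div_mul_left _ _ two_ne_zero]
      rw [← hSA] at h₂
      have hpos : (0 : ℝ) < 2 ^ (c + s + 2) := by positivity
      have h₄ := hF.trans h₁
      rw [div_le_iff₀ hpos] at h₂ h₄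
      rw [div_le_iff₀ hpos, add_mul, div_mul_cancel₀ _ hpos.ne', Nat.cast_max]
      have h₅ : (B s : ℝ) ≤ ((B s - max (A s) (alloc A B s).1 : ℕ) : ℝ) +
          max (A s : ℝ) ((alloc A B s).1 : ℝ) := by
        exact_mod_cast (tsub_le_iff_right.1 le_rfl :
          B s ≤ B s - max (A s) (alloc A B s).1 + max (A s) (alloc A B s).1)
      have h₆ : (0 : ℝ) ≤ ((B s - max (A s) (alloc A B s).1 : ℕ) : ℝ) := Nat.cast_nonneg _
      refine max_le (by linarith) (h₅.trans ?_)
      rw [add_comm]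
      gcongr
      exact max_le h₂ h₄

/-- The targets derived from a sequence of rational intervals: stage `s` looks at the interval
with index `s.unpair.1` and aims at its right end point once the approximation `A s` has passed its
left end point. -/
def targets (I : ℕ → ℕ → ℚ × ℚ) (A : ℕ → ℕ → ℕ) (j s : ℕ) : ℕ :=
  bif decide (⌈(I (2 * j + 2) s.unpair.1).1 * 2 ^ (2 * j + 1 + s + 2)⌉₊ ≤ A j s) then
    ⌈(I (2 * j + 2) s.unpair.1).2 * 2 ^ (2 * j + 1 + s + 2)⌉₊ else 0

theorem computable_targets {I : ℕ → ℕ → ℚ × ℚ} {A : ℕ → ℕ → ℕ} (hI : Computable₂ I)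
    (hA : Computable₂ A) : Computable₂ (targets I A) := by
  have hn : Primrec fun p : ℕ × ℕ => 2 * p.1 + 2 :=
    Primrec.nat_add.comp (Primrec.nat_double.comp Primrec.fst) (Primrec.const 2)
  have hK : Primrec fun p : ℕ × ℕ => 2 * p.1 + 1 + p.2 + 2 :=
    Primrec.nat_add.comp (Primrec.nat_add.comp (Primrec.nat_add.comp
      (Primrec.nat_double.comp Primrec.fst) (Primrec.const 1)) Primrec.snd) (Primrec.const 2)
  have hk : Primrec fun p : ℕ × ℕ => p.2.unpair.1 :=
    Primrec.fst.comp (Primrec.unpair.comp Primrec.snd)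
  have hIk := hI.comp hn.to_comp hk.to_comp
  have h₁ := Rat.computable_natCeil_mul_two_pow.comp (Computable.fst.comp hIk) hK.to_comp
  have h₂ := Rat.computable_natCeil_mul_two_pow.comp (Computable.snd.comp hIk) hK.to_comp
  exact Computable.cond (Primrec.nat_le.decide.to_comp.comp h₁ hA) h₂ (Computable.const 0)

theorem Ioo_subset_of_lt_targets {I : ℕ → ℕ → ℚ × ℚ} {A : ℕ → ℕ → ℕ} {j s : ℕ}
    (h : A j s < targets I A j s) :
    Set.Ioo ((A j s : ℝ) / 2 ^ (2 * j + 1 + s + 2))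
      (((targets I A j s : ℝ) - 1) / 2 ^ (2 * j + 1 + s + 2)) ⊆
        ⋃ k : ℕ, Set.Ioo ((I (2 * j + 2) k).1 : ℝ) ((I (2 * j + 2) k).2 : ℝ) := by
  have hpos : (0 : ℝ) < 2 ^ (2 * j + 1 + s + 2) := by positivity
  refine Set.subset_iUnion_of_subset s.unpair.1 ?_
  by_cases hA : ⌈(I (2 * j + 2) s.unpair.1).1 * 2 ^ (2 * j + 1 + s + 2)⌉₊ ≤ A j s
  · have ht : targets I A j s = ⌈(I (2 * j + 2) s.unpair.1).2 * 2 ^ (2 * j + 1 + s + 2)⌉₊ := by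
      rw [targets, decide_eq_true hA, cond_true]
    refine Set.Ioo_subset_Ioo ?_ ?_
    · rw [le_div_iff₀ hpos]
      exact_mod_cast Nat.ceil_le.1 hA
    · rw [div_le_iff₀ hpos, sub_le_iff_le_add, ht]
      have h₁ : 0 < (I (2 * j + 2) s.unpair.1).2 * 2 ^ (2 * j + 1 + s + 2) :=
        Nat.ceil_pos.1 (by omega)
      exact_mod_cast (Nat.ceil_lt_add_one h₁.le).le
  · rw [targets, decide_eq_false hA, cond_false] at h
    omega

theorem le_targets_div {I : ℕ → ℕ → ℚ × ℚ} {A : ℕ → ℕ → ℕ} {j s k : ℕ}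
    (hs : s.unpair.1 = k)
    (h : ((I (2 * j + 2) k).1 : ℝ) ≤ (A j s : ℝ) / 2 ^ (2 * j + 1 + s + 2)) :
    ((I (2 * j + 2) k).2 : ℝ) ≤ (targets I A j s : ℝ) / 2 ^ (2 * j + 1 + s + 2) := by
  have hpos : (0 : ℝ) < 2 ^ (2 * j + 1 + s + 2) := by positivity
  subst hs
  rw [le_div_iff₀ hpos] at h ⊢
  have hA : ⌈(I (2 * j + 2) s.unpair.1).1 * 2 ^ (2 * j + 1 + s + 2)⌉₊ ≤ A j s :=
    Nat.ceil_le.2 (by exact_mod_cast h)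
  rw [targets, decide_eq_true hA, cond_true]
  exact_mod_cast Nat.le_ceil ((I (2 * j + 2) s.unpair.1).2 * 2 ^ (2 * j + 1 + s + 2))

theorem exists_allocMachine_dom {A B : ℕ → ℕ → ℕ} (hA : Computable₂ A) (hB : Computable₂ B)
    {j s : ℕ} (h : (alloc (A j) (B j) s).2 + (B j s - max (A j s) (alloc (A j) (B j) s).1) ≤
      2 ^ (s + 2)) :
    ∃ T : Finset (List Bool), (∀ σ ∈ T, ((allocMachine hA hB).f σ).Dom) ∧
      (∀ σ ∈ T, σ.length = j + s + 3) ∧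
      T.card = B j s - max (A j s) (alloc (A j) (B j) s).1 := by
  choose! p hp using exists_binVal_eq (s + 2)
  refine ⟨(Finset.Ico (alloc (A j) (B j) s).2 ((alloc (A j) (B j) s).2 +
    (B j s - max (A j s) (alloc (A j) (B j) s).1))).image
      fun v => List.replicate j false ++ true :: p v, fun σ hσ => ?_, fun σ hσ => ?_, ?_⟩
  · obtain ⟨v, hv, rfl⟩ := Finset.mem_image.1 hσ
    rw [Finset.mem_Ico] at hv
    obtain ⟨h₁, h₂⟩ := hp v (by omega)
    exact allocMachine_dom hA hB j s h₁ (by omega) (by omega)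
  · obtain ⟨v, hv, rfl⟩ := Finset.mem_image.1 hσ
    rw [Finset.mem_Ico] at hv
    rw [List.length_append, List.length_replicate, List.length_cons, (hp v (by omega)).1]
    omega
  · rw [Finset.card_image_of_injOn, Nat.card_Ico, Nat.add_sub_cancel_left]
    intro v hv w hw hvw
    rw [Finset.coe_Ico, Set.mem_Ico] at hv hw
    have h₁ : p v = p w := by simpa using hvw
    rw [← (hp v (by omega)).2, h₁, (hp w (by omega)).2]

/-- If U is a universal prefix-free machine and M is any prefix-free
machine whose domain contains the domain of U, then Ω_M is Martin-Löf random. -/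
theorem stmt_4 (U M : PFMachine) (hU : UniversalPF U)
    (hdom : {σ : List Bool | (U.f σ).Dom} ⊆ {σ : List Bool | (M.f σ).Dom}) :
    MLRandom (omegaOf M) := by
  intro I hI hvol hmem
  obtain ⟨H, hH, hHmono, hHdom⟩ := M.exists_stages
  set A : ℕ → ℕ → ℕ := fun j s => stageSum H s (2 * j + 1 + s + 2)
  have hA : Computable₂ A :=
    (computable_stageSum hH).comp Computable.snd (Primrec.to_comp
      (Primrec.nat_add.comp (Primrec.nat_add.comp (Primrec.nat_add.comp
        (Primrec.nat_double.comp Primrec.fst) (Primrec.const 1)) Primrec.snd) (Primrec.const 2)))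
  have hB := computable_targets hI hA
  obtain ⟨ρ, hρ⟩ := hU (allocMachine hA hB)
  obtain ⟨j, hj⟩ : ∃ j, j = ρ.length := ⟨_, rfl⟩
  have hSA (s : ℕ) : (A j s : ℝ) / 2 ^ (2 * j + 1 + s + 2) =
      ∑ σ ∈ stageSet H s, (1 / 2 : ℝ) ^ σ.length :=
    stageSum_div_two_pow H (by omega)
  have hSD (s : ℕ) : ∀ σ ∈ stageSet H s, σ ∈ {σ : List Bool | (M.f σ).Dom} :=
    fun σ hσ => (hHdom σ).2 ⟨s, (Finset.mem_filter.1 hσ).2⟩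
  have hT (s : ℕ) : ∃ T : Finset (List Bool), (∀ σ ∈ T, σ ∈ {σ : List Bool | (M.f σ).Dom}) ∧
      (∀ σ ∈ T, σ.length = 2 * j + 1 + s + 2) ∧
      T.card = targets I A j s - max (A j s) (alloc (A j) (targets I A j) s).1 := by
    obtain ⟨T, hTD, hTl, hTc⟩ := exists_allocMachine_dom hA hB
      (alloc_snd_add_le (A := A j) (2 * j + 1) (hvol (2 * j + 2))
        (fun t => Ioo_subset_of_lt_targets) s)
    refine ⟨T.image (ρ ++ ·), fun σ hσ => ?_, fun σ hσ => ?_, ?_⟩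
    · obtain ⟨τ, hτ, rfl⟩ := Finset.mem_image.1 hσ
      refine hdom ?_
      change (U.f (ρ ++ τ)).Dom
      rw [hρ]
      exact hTD τ hτ
    · obtain ⟨τ, hτ, rfl⟩ := Finset.mem_image.1 hσ
      rw [List.length_append, hTl τ hτ]
      omega
    · rw [Finset.card_image_of_injective _ (List.append_right_injective ρ), hTc]
  have hle (s : ℕ) : ((alloc (A j) (targets I A j) s).1 : ℝ) / 2 ^ (2 * j + 1 + s + 2) ≤
      omegaOf M := by
    obtain ⟨F, hFD, -, hF⟩ := exists_finset_alloc_le (2 * j + 1) hSD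
      (fun s σ => length_lt_of_mem_stageSet) hSA hT s
    exact hF.trans (sum_le_omegaOf M hFD)
  obtain ⟨k, hk₁, hk₂⟩ := Set.mem_iUnion.1 (Set.mem_iInter.1 hmem (2 * j + 2))
  obtain ⟨F, hFD, hF⟩ := exists_finset_lt_sum M hk₁
  obtain ⟨t, ht⟩ := exists_subset_stageSet hHmono fun σ hσ => (hHdom σ).1 (hFD σ hσ)
  have hA' : ((I (2 * j + 2) k).1 : ℝ) ≤
      (A j (Nat.pair k t) : ℝ) / 2 ^ (2 * j + 1 + Nat.pair k t + 2) := by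
    rw [hSA]
    exact hF.le.trans (Finset.sum_le_sum_of_subset_of_nonneg (ht _ (Nat.right_le_pair k t))
      fun σ _ _ => by positivity)
  have hb := le_targets_div (by rw [Nat.unpair_pair]) hA'
  have hr := hle (Nat.pair k t + 1)
  have hK : (2 : ℝ) ^ (2 * j + 1 + (Nat.pair k t + 1) + 2) =
      2 * 2 ^ (2 * j + 1 + Nat.pair k t + 2) := by ring
  rw [alloc, hK, Nat.cast_mul, Nat.cast_ofNat, mul_div_mul_left _ _ two_ne_zero] at hr
  refine absurd (hk₂.trans_le (hb.trans (le_trans ?_ hr))) (lt_irrefl _)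
  gcongr
  exact le_max_right _ _
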